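/- arXiv:2406.02397 — 4 statements merged into one kernel-verified Lean document; each statement's English description precedes it below -/
import Mathlib

section
/- Fix an integer $d \ge 3$ and set $K_1 = 1/d$ and $K_2 = 2000d$. Let $C > 1$ be a real constant and define $\lambda(x) := C\exp\big(\ln^{1/2}(x)\,\ln\ln(x)\big)$ for $x > 0$, where the convention $\ln a := 0$ for $a < 1$ is applied to each logarithm (so $\ln x$ is replaced by $\max(\ln x, 0)$ and likewise for the iterated logarithm). Then for every real number $N$ with $N \ge C^{1/d}$ and $N \ge \exp(\exp(10^6 d^2))$, and every real $M \in [1, N^d]$, one has $\dfrac{\lambda(N)}{\lambda\big(N\,(\lambda(N) M)^{-K_1}\big)} \ge \big(\ln(\lambda(N) M)\big)^{K_2}$. -/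
/-- The logarithm with the convention `ln a := 0` for `a < 1`. -/
noncomputable def plog (x : ℝ) : ℝ := max (Real.log x) 0

/-- The correction function `λ(x) = C exp(ln^{1/2}(x) ln ln (x))`, with the
convention `ln a := 0` for `a < 1` applied to each logarithm. -/
noncomputable def lamFn (C x : ℝ) : ℝ :=
  C * Real.exp (Real.sqrt (plog x) * plog (plog x))

theorem plog_nonneg (x : ℝ) : 0 ≤ plog x := le_max_right _ _

theorem plog_le_log {x y : ℝ} (hx : 0 ≤ x) (hxy : x ≤ y) (hy : 1 ≤ y) :
    plog x ≤ Real.log y := by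
  refine max_le ?_ (Real.log_nonneg hy)
  rcases hx.eq_or_lt with rfl | hx
  · simpa using Real.log_nonneg hy
  · exact Real.log_le_log hx hxy

theorem lamFn_pos {C : ℝ} (hC : 0 < C) (x : ℝ) : 0 < lamFn C x :=
  mul_pos hC (Real.exp_pos _)

theorem log_lamFn {C : ℝ} (hC : 0 < C) (x : ℝ) :
    Real.log (lamFn C x) = Real.log C + Real.sqrt (plog x) * plog (plog x) := by
  rw [lamFn, Real.log_mul hC.ne' (Real.exp_ne_zero _), Real.log_exp]

/-- Removing at least `a √L` from `L`, truncating at zero, lowers its square root by `a / 2`. -/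
theorem sqrt_max_sub_le {L a t : ℝ} (hL : 0 ≤ L) (ha : a / 2 ≤ Real.sqrt L)
    (ht : a * Real.sqrt L ≤ t) :
    Real.sqrt (max (L - t) 0) ≤ Real.sqrt L - a / 2 := by
  refine Real.sqrt_le_iff.mpr ⟨by linarith, max_le ?_ (sq_nonneg _)⟩
  nlinarith [Real.sq_sqrt hL, sq_nonneg a]


theorem stmt_0 (d : ℕ) (hd : 3 ≤ d) (C : ℝ) (hC : 1 < C)
    (N M : ℝ)
    (hN1 : C ^ ((1 : ℝ) / d) ≤ N)
    (hN2 : Real.exp (Real.exp (10 ^ 6 * (d : ℝ) ^ 2)) ≤ N)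
    (hM1 : 1 ≤ M) (hM2 : M ≤ N ^ (d : ℝ)) :
    (plog (lamFn C N * M)) ^ ((2000 : ℝ) * d) ≤
      lamFn C N / lamFn C (N * (lamFn C N * M) ^ (-(1 / (d : ℝ)))) := by
  have hd' : (3 : ℝ) ≤ d := by exact_mod_cast hd
  have hd0 : (0 : ℝ) < d := by linarith
  have hC0 : 0 < C := by linarith
  have hN0 : 0 < N := (Real.exp_pos _).trans_le hN2
  have hM0 : 0 < M := by linarith
  set L := Real.log N with hL
  have hLge : Real.exp (10 ^ 6 * (d : ℝ) ^ 2) ≤ L := (Real.le_log_iff_exp_le hN0).mpr hN2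
  have hL0 : 0 < L := (Real.exp_pos _).trans_le hLge
  set l := Real.log L with hl
  have hlge : 10 ^ 6 * (d : ℝ) ^ 2 ≤ l := (Real.le_log_iff_exp_le hL0).mpr hLge
  have hl0 : 0 < l := lt_of_lt_of_le (by positivity) hlge
  have hL1 : 1 ≤ L := (Real.one_le_exp (by positivity)).trans hLge
  have hpN : plog N = L := max_eq_left hL0.le
  have hpL : plog L = l := max_eq_left hl0.le
  set s := Real.sqrt L with hs
  have hs0 : 0 < s := Real.sqrt_pos.mpr hL0
  have hss : s ^ 2 = L := Real.sq_sqrt hL0.le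
  have hls : l ≤ 2 * s := by
    have h : l = 2 * Real.log s := by rw [hl, ← hss, Real.log_pow]; norm_num
    linarith [Real.log_le_self hs0.le]
  have hc : Real.log C ≤ d * L := by
    have h := Real.log_le_log (by positivity) hN1
    rw [Real.log_rpow hC0, one_div_mul_eq_div, div_le_iff₀ hd0] at h
    linarith
  have hc0 : 0 ≤ Real.log C := Real.log_nonneg hC.le
  have hm : Real.log M ≤ d * L := by
    have h := Real.log_le_log hM0 hM2
    rwa [Real.log_rpow hN0] at h
  have hm0 : 0 ≤ Real.log M := Real.log_nonneg hM1
  have hlam := lamFn_pos hC0 N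
  have hlogN : Real.log (lamFn C N) = Real.log C + s * l := by
    rw [log_lamFn hC0, hpN, hpL]
  set A := lamFn C N * M with hA
  have hA0 : 0 < A := mul_pos hlam hM0
  set T := Real.log A with hT
  have hTeq : T = Real.log C + s * l + Real.log M := by
    rw [hT, hA, Real.log_mul hlam.ne' hM0.ne', hlogN]
  have hTge : s * l ≤ T := by linarith
  have hT0 : 0 < T := (mul_pos hs0 hl0).trans_le hTge
  have hpA : plog A = T := max_eq_left hT0.le
  have hTle : T ≤ 3 * d * L := by nlinarith
  have hlogT : Real.log T ≤ 2 * l := by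
    have h := Real.log_le_log hT0 hTle
    rw [Real.log_mul (by positivity) hL0.ne'] at h
    have h3 := Real.log_le_self (x := 3 * (d : ℝ)) (by positivity)
    nlinarith
  have hlogx : plog (N * A ^ (-(1 / (d : ℝ)))) = max (L - T / d) 0 := by
    rw [plog, Real.log_mul hN0.ne' (Real.rpow_pos_of_pos hA0 _).ne', Real.log_rpow hA0]
    congr 1
    ring
  set x := N * A ^ (-(1 / (d : ℝ)))
  have hsqrt : Real.sqrt (plog x) ≤ s - l / d / 2 := by
    rw [hlogx]
    refine sqrt_max_sub_le hL0.le ?_ ?_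
    · have : l / d ≤ l := div_le_self hl0.le (by linarith)
      linarith
    · rw [div_mul_eq_mul_div]
      gcongr
      linarith
  have hpx : plog (plog x) ≤ l := by
    refine plog_le_log (plog_nonneg x) ?_ hL1
    rw [hlogx]
    exact max_le (sub_le_self _ (by positivity)) hL0.le
  have hprod : Real.sqrt (plog x) * plog (plog x) ≤ (s - l / d / 2) * l :=
    mul_le_mul hsqrt hpx (plog_nonneg _) ((Real.sqrt_nonneg _).trans hsqrt)
  have hgain : 2000 * d * (2 * l) ≤ l / d / 2 * l := by
    have h : 4000 * (d : ℝ) ≤ l / d / 2 := by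
      rw [div_div, le_div_iff₀ (by positivity)]
      nlinarith
    nlinarith
  rw [hpA, ← Real.log_le_log_iff (by positivity) (div_pos hlam (lamFn_pos hC0 x)),
    Real.log_rpow hT0, Real.log_div hlam.ne' (lamFn_pos hC0 x).ne', hlogN, log_lamFn hC0]
  have : 2000 * d * Real.log T ≤ 2000 * d * (2 * l) := by gcongr
  linarith
end

section
/- Let $U$ be a nonnegative real random variable on a probability space, and let $a > 0$, $c \in (0, 1/100]$, $T > 0$ and $\epsilon_0 \in (0, c)$ be real numbers such that $2 c^2 a\, \epsilon_0^{-1} \big(\log_2(1/\epsilon_0)\big)^{-2} \ge 2T$. Suppose that $\mathbb{E}\big[1 - e^{-2U}\big] \ge a/2$ and $\mathbb{P}(U \ge T) < a/8$. Then there exists $\epsilon \in (\epsilon_0, c)$ such that $\mathbb{P}\Big(U \ge 2 c^2 a\, \epsilon^{-1}\big(\log_2(1/\epsilon)\big)^{-2}\Big) \ge 2\epsilon$. -/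
open MeasureTheory

/-- A real number below the last of finitely many nonnegative levels is bounded by the first level
plus the successors of the levels that it exceeds. -/
theorem le_add_sum_indicator_of_lt {Ω : Type*} {U : Ω → ℝ} {t : ℕ → ℝ} (ht : ∀ k, 0 ≤ t k)
    (ω : Ω) (N : ℕ) (h : U ω < t N) :
    U ω ≤ t 0 + ∑ k ∈ Finset.range N, t (k + 1) * {ω | t k ≤ U ω}.indicator 1 ω := by
  induction N with
  | zero => simpa using h.le
  | succ n ih =>
    rw [Finset.sum_range_succ]
    by_cases hn : U ω < t n
    · have : {ω | t n ≤ U ω}.indicator (1 : Ω → ℝ) ω = 0 :=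
        Set.indicator_of_notMem (by simpa using hn) _
      rw [this, mul_zero, add_zero]
      exact ih hn
    · have : {ω | t n ≤ U ω}.indicator (1 : Ω → ℝ) ω = 1 :=
        Set.indicator_of_mem (by simpa using hn) _
      rw [this, mul_one]
      have hsum : 0 ≤ ∑ k ∈ Finset.range n, t (k + 1) * {ω | t k ≤ U ω}.indicator 1 ω :=
        Finset.sum_nonneg fun k _ ↦
          mul_nonneg (ht _) (Set.indicator_nonneg (fun _ _ ↦ zero_le_one) _)
      linarith [ht 0]

/-- Discrete layer-cake bound for `𝔼[1 - exp (-2 U)]`. -/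
theorem integral_one_sub_exp_le {Ω : Type*} [MeasurableSpace Ω] (μ : Measure Ω)
    [IsProbabilityMeasure μ] {U : Ω → ℝ} (hUm : Measurable U) (hU0 : ∀ ω, 0 ≤ U ω)
    {t : ℕ → ℝ} (ht : ∀ k, 0 ≤ t k) {N : ℕ} {T : ℝ} (hT : T ≤ t N) :
    ∫ ω, (1 - Real.exp (-2 * U ω)) ∂μ ≤
      2 * (t 0 + ∑ k ∈ Finset.range N, t (k + 1) * μ.real {ω | t k ≤ U ω})
        + μ.real {ω | T ≤ U ω} := by
  have hms (s : ℝ) : MeasurableSet {ω | s ≤ U ω} := measurableSet_le measurable_const hUm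
  have hint (s : ℝ) : Integrable ({ω | s ≤ U ω}.indicator (1 : Ω → ℝ)) μ :=
    (integrable_const (1 : ℝ)).indicator (hms s)
  have hsum : Integrable (fun ω ↦ ∑ k ∈ Finset.range N,
      t (k + 1) * {ω | t k ≤ U ω}.indicator (1 : Ω → ℝ) ω) μ :=
    integrable_finsetSum _ fun k _ ↦ (hint _).const_mul _
  have hadd : Integrable (fun ω ↦ t 0 + ∑ k ∈ Finset.range N,
      t (k + 1) * {ω | t k ≤ U ω}.indicator (1 : Ω → ℝ) ω) μ :=
    (integrable_const _).add hsum
  have hexp : Integrable (fun ω ↦ 1 - Real.exp (-2 * U ω)) μ := by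
    refine Integrable.of_bound (by fun_prop) 1 (.of_forall fun ω ↦ ?_)
    have h1 : Real.exp (-2 * U ω) ≤ 1 := Real.exp_le_one_iff.2 (by linarith [hU0 ω])
    rw [Real.norm_eq_abs, abs_le]
    constructor <;> linarith [Real.exp_pos (-2 * U ω)]
  calc ∫ ω, (1 - Real.exp (-2 * U ω)) ∂μ
      ≤ ∫ ω, (2 * (t 0 + ∑ k ∈ Finset.range N,
          t (k + 1) * {ω | t k ≤ U ω}.indicator (1 : Ω → ℝ) ω)
          + {ω | T ≤ U ω}.indicator (1 : Ω → ℝ) ω) ∂μ := by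
        refine integral_mono hexp ((hadd.const_mul 2).add (hint T)) fun ω ↦ ?_
        by_cases hω : U ω < T
        · have h0 : {ω | T ≤ U ω}.indicator (1 : Ω → ℝ) ω = 0 :=
            Set.indicator_of_notMem (by simpa using hω) _
          have := le_add_sum_indicator_of_lt ht ω N (hω.trans_le hT)
          simp only [h0]
          linarith [Real.add_one_le_exp (-2 * U ω)]
        · have h1 : {ω | T ≤ U ω}.indicator (1 : Ω → ℝ) ω = 1 :=
            Set.indicator_of_mem (by simpa using hω) _
          have hs : 0 ≤ ∑ k ∈ Finset.range N, t (k + 1) * {ω | t k ≤ U ω}.indicator 1 ω :=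
            Finset.sum_nonneg fun k _ ↦
              mul_nonneg (ht _) (Set.indicator_nonneg (fun _ _ ↦ zero_le_one) _)
          simp only [h1]
          linarith [Real.exp_pos (-2 * U ω), ht 0]
    _ = _ := by
        rw [integral_add (hadd.const_mul 2) (hint T), integral_const_mul,
          integral_add (integrable_const _) hsum,
          integral_finsetSum _ fun k _ ↦ (hint _).const_mul _]
        simp [integral_const_mul, integral_indicator_one (hms _)]

theorem sum_inv_sq_le {x : ℝ} (hx : 0 < x) (N : ℕ) :
    ∑ k ∈ Finset.range N, ((x + k + 1) ^ 2)⁻¹ ≤ x⁻¹ - (x + N)⁻¹ := by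
  induction N with
  | zero => simp
  | succ n ih =>
    rw [Finset.sum_range_succ]
    have hy : 0 < x + n := by positivity
    have key : ((x + n + 1) ^ 2)⁻¹ ≤ (x + n)⁻¹ - (x + n + 1)⁻¹ := by
      rw [inv_sub_inv hy.ne' (by positivity), inv_eq_one_div,
        div_le_div_iff₀ (by positivity) (by positivity)]
      nlinarith
    push_cast
    rw [← add_assoc]
    linarith

theorem stmt_1 {Ω : Type*} [MeasurableSpace Ω] (μ : Measure Ω) [IsProbabilityMeasure μ]
    (U : Ω → ℝ) (hUm : Measurable U) (hU0 : ∀ ω, 0 ≤ U ω)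
    (a c T ε₀ : ℝ) (ha : 0 < a) (hc0 : 0 < c) (hc1 : c ≤ 1 / 100)
    (hT : 0 < T) (hε₀0 : 0 < ε₀) (hε₀c : ε₀ < c)
    (hcond : 2 * T ≤ 2 * c ^ 2 * a * ε₀⁻¹ * ((Real.logb 2 (1 / ε₀)) ^ 2)⁻¹)
    (hE : a / 2 ≤ ∫ ω, (1 - Real.exp (-2 * U ω)) ∂μ)
    (hTail : (μ {ω | T ≤ U ω}).toReal < a / 8) :
    ∃ ε, ε₀ < ε ∧ ε < c ∧
      2 * ε ≤ (μ {ω | 2 * c ^ 2 * a * ε⁻¹ * ((Real.logb 2 (1 / ε)) ^ 2)⁻¹ ≤ U ω}).toReal := by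
  by_contra! hcon
  set Λ := Real.logb 2 (1 / c) with hΛ
  have hΛ6 : 6 ≤ Λ := by
    rw [hΛ, Real.le_logb_iff_rpow_le one_lt_two (by positivity), le_div_iff₀ hc0]
    norm_num
    linarith
  have hL0 : Λ ≤ Real.logb 2 (1 / ε₀) :=
    Real.logb_le_logb_of_le one_lt_two (by positivity)
      (one_div_le_one_div_of_le hε₀0 hε₀c.le)
  set x : ℕ → ℝ := fun k ↦ c / 2 ^ (k + 1) with hx
  have hxpos (k : ℕ) : 0 < x k := by positivity
  have hxsucc (k : ℕ) : x (k + 1) = x k / 2 := by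
    simp only [hx, pow_succ]; field_simp
  have hxlog (k : ℕ) : Real.logb 2 (1 / x k) = Λ + k + 1 := by
    have : 1 / x k = (1 / c) * 2 ^ (k + 1) := by simp only [hx]; field_simp
    rw [this, Real.logb_mul (by positivity) (by positivity), Real.logb_pow,
      Real.logb_self_eq_one one_lt_two]
    push_cast
    ring
  set t : ℕ → ℝ := fun k ↦ 2 * c ^ 2 * a * (x k)⁻¹ * ((Λ + k + 1) ^ 2)⁻¹ with ht
  have htpos (k : ℕ) : 0 ≤ t k := by have := hxpos k; positivity
  have hex : ∃ N, x N ≤ ε₀ := by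
    obtain ⟨n, hn⟩ := exists_pow_lt_of_lt_one (div_pos hε₀0 hc0) (one_half_lt_one (α := ℝ))
    refine ⟨n, ?_⟩
    rw [lt_div_iff₀ hc0] at hn
    have : x n = (1 / 2) ^ n * c / 2 := by
      simp only [hx, pow_succ, one_div, inv_pow]; field_simp
    have := hxpos n
    linarith
  obtain ⟨N, hN, hmin⟩ : ∃ N, x N ≤ ε₀ ∧ ∀ k < N, ε₀ < x k := by
    classical
    exact ⟨Nat.find hex, Nat.find_spec hex, fun k hk ↦ not_le.1 (Nat.find_min hex hk)⟩
  have hNlow : ε₀ / 2 ≤ x N := by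
    rcases N with _ | n
    · simp only [hx, zero_add, pow_one]; linarith
    · rw [hxsucc]; linarith [hmin n (Nat.lt_succ_self n)]
  have hTN : T ≤ t N := by
    have hlog : Λ + N + 1 ≤ Real.logb 2 (1 / ε₀) + 1 := by
      have h2 : Real.logb 2 (1 / ε₀) + 1 = Real.logb 2 (1 / (ε₀ / 2)) := by
        rw [show 1 / (ε₀ / 2) = (1 / ε₀) * 2 by field_simp,
          Real.logb_mul (by positivity) two_ne_zero, Real.logb_self_eq_one one_lt_two]
      rw [h2, ← hxlog]
      exact Real.logb_le_logb_of_le one_lt_two (by have := hxpos N; positivity)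
        (one_div_le_one_div_of_le (by positivity) hNlow)
    have hsq : (Λ + N + 1) ^ 2 ≤ 2 * (Real.logb 2 (1 / ε₀)) ^ 2 := by
      have : (Λ + N + 1) ^ 2 ≤ (Real.logb 2 (1 / ε₀) + 1) ^ 2 := by gcongr
      nlinarith
    have hinv : (2 * (Real.logb 2 (1 / ε₀)) ^ 2)⁻¹ ≤ ((Λ + N + 1) ^ 2)⁻¹ := by gcongr
    have hxinv : ε₀⁻¹ ≤ (x N)⁻¹ := inv_anti₀ (hxpos N) hN
    have : 2 * c ^ 2 * a * ε₀⁻¹ * (2 * (Real.logb 2 (1 / ε₀)) ^ 2)⁻¹ ≤ t N := by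
      have := hxpos N
      simp only [ht]
      gcongr
    rw [mul_inv] at this
    linarith
  have hbound := integral_one_sub_exp_le μ hUm hU0 htpos hTN
  have hterm : ∀ k ∈ Finset.range N, t (k + 1) * μ.real {ω | t k ≤ U ω} ≤
      8 * c ^ 2 * a * ((Λ + 1 + k + 1) ^ 2)⁻¹ := by
    intro k hk
    have hxk : x k < c := div_lt_self hc0 (one_lt_pow₀ one_lt_two k.succ_ne_zero)
    have hP := hcon (x k) (hmin k (Finset.mem_range.1 hk)) hxk
    rw [hxlog] at hP
    calc t (k + 1) * μ.real {ω | t k ≤ U ω} ≤ t (k + 1) * (2 * x k) :=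
          mul_le_mul_of_nonneg_left hP.le (htpos _)
      _ = 8 * c ^ 2 * a * ((Λ + 1 + k + 1) ^ 2)⁻¹ := by
          have := (hxpos k).ne'
          simp only [ht, hxsucc]
          push_cast
          rw [show Λ + (k + 1) + 1 = Λ + 1 + k + 1 by ring]
          field_simp
          ring
  have hsum : ∑ k ∈ Finset.range N, t (k + 1) * μ.real {ω | t k ≤ U ω} ≤ 8 * c ^ 2 * a := by
    refine (Finset.sum_le_sum hterm).trans ?_
    rw [← Finset.mul_sum]
    refine mul_le_of_le_one_right (by positivity) ?_
    have h1 := sum_inv_sq_le (show 0 < Λ + 1 by linarith) N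
    have h2 : 0 ≤ (Λ + 1 + N)⁻¹ := by positivity
    have h3 : (Λ + 1)⁻¹ ≤ 1 := inv_le_one_of_one_le₀ (by linarith)
    linarith
  have ht0 : t 0 ≤ 4 * c * a := by
    have : t 0 = 4 * c * a * ((Λ + 1) ^ 2)⁻¹ := by
      simp only [ht, hx]
      push_cast
      rw [add_zero]
      field_simp
      ring
    rw [this]
    exact mul_le_of_le_one_right (by positivity) (inv_le_one_of_one_le₀ (by nlinarith))
  have hca : c * a ≤ 1 / 100 * a := by gcongr
  have hc2a : c ^ 2 * a ≤ (1 / 100) ^ 2 * a := by gcongr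
  change μ.real _ < _ at hTail
  linarith
end

section
/- Let $d \ge 3$ be an integer, let $k$ be an integer with $k \ge 100 d \log_2(10 d)$, and let $\widehat N \ge 1$ be a real number with $2^{-k}\widehat N^d \ge 2$. Let $x \in \mathbb{Z}^d$ and let $A \subseteq B_x(2\widehat N)$ be a finite set of lattice points with $|A| \ge 2^{-k}\widehat N^d$. Suppose an integer $l \ge 1$ satisfies the heavy-annulus property $\sum_{y \in A \cap (B_x(2^{2-l}\widehat N) \setminus B_x(2^{1-l}\widehat N))} |x-y|^{2-d} \ge \tfrac12 l^{-2} \sum_{y \in A \setminus \{x\}} |x-y|^{2-d}$. Then: (i) $l \le k$; (ii) $2^{-l} \ge d^{-4d} k^{-1} 2^{-k/2}$; and (iii) $\sum_{y \in A \cap (B_x(2^{2-l}\widehat N) \setminus B_x(2^{1-l}\widehat N))} |x-y|^{2-d} \ge \tfrac12 d^{-2d} k^{-2} 2^{-k} \widehat N^2$. -/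
open Classical

/-- Euclidean distance between two points of `ℤ^d`. -/
noncomputable def eDist (d : ℕ) (x y : Fin d → ℤ) : ℝ :=
  Real.sqrt (∑ i, ((x i - y i : ℤ) : ℝ) ^ 2)

/-- `|x-y|^a` with the convention `0^a := 1` (used for negative exponents `a`). -/
noncomputable def invPow (d : ℕ) (a : ℝ) (x y : Fin d → ℤ) : ℝ :=
  if x = y then 1 else (eDist d x y) ^ a

/-- `y ∈ B_x(r)`, the sup-norm box of radius `r` centered at `x`. -/
def inBox (d : ℕ) (x : Fin d → ℤ) (r : ℝ) (y : Fin d → ℤ) : Prop :=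
  ∀ i, |((y i - x i : ℤ) : ℝ)| ≤ r

lemma abs_coord_le_eDist (d : ℕ) (x y : Fin d → ℤ) (i : Fin d) :
    |((y i - x i : ℤ) : ℝ)| ≤ eDist d x y := by
  refine Real.le_sqrt_of_sq_le ?_
  have h : ((x i - y i : ℤ) : ℝ) ^ 2 ≤ ∑ j, ((x j - y j : ℤ) : ℝ) ^ 2 :=
    Finset.single_le_sum (f := fun j => ((x j - y j : ℤ) : ℝ) ^ 2)
      (fun j _ => sq_nonneg _) (Finset.mem_univ i)
  refine le_trans (le_of_eq ?_) h
  rw [sq_abs]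
  push_cast
  ring

lemma eDist_pos {d : ℕ} {x y : Fin d → ℤ} (h : x ≠ y) : 0 < eDist d x y := by
  obtain ⟨i, hi⟩ := Function.ne_iff.mp h
  refine lt_of_lt_of_le ?_ (abs_coord_le_eDist d x y i)
  rw [abs_pos, Int.cast_ne_zero]
  omega

lemma eDist_le_of_inBox {d : ℕ} {x y : Fin d → ℤ} {r : ℝ} (hd : 1 ≤ d) (hr : 0 ≤ r)
    (h : inBox d x r y) : eDist d x y ≤ d * r := by
  have hd' : (1 : ℝ) ≤ d := by exact_mod_cast hd
  refine Real.sqrt_le_iff.mpr ⟨by positivity, ?_⟩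
  have hsum : ∑ i, ((x i - y i : ℤ) : ℝ) ^ 2 ≤ ∑ _i : Fin d, r ^ 2 := by
    refine Finset.sum_le_sum fun i _ => ?_
    rw [show ((x i - y i : ℤ) : ℝ) ^ 2 = |((y i - x i : ℤ) : ℝ)| ^ 2 by
      rw [sq_abs]; push_cast; ring]
    exact pow_le_pow_left₀ (abs_nonneg _) (h i) 2
  rw [Finset.sum_const, Finset.card_univ, Fintype.card_fin, nsmul_eq_mul] at hsum
  nlinarith [mul_nonneg (mul_nonneg (sub_nonneg.mpr hd') (Nat.cast_nonneg' d : (0 : ℝ) ≤ d))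
    (sq_nonneg r)]

lemma rpow_two_sub_natCast {t : ℝ} (ht : 0 < t) (d : ℕ) :
    t ^ ((2 : ℝ) - d) = t ^ 2 / t ^ d := by
  rw [Real.rpow_sub ht, Real.rpow_natCast, Real.rpow_two]

lemma le_invPow_of_inBox {d : ℕ} {x y : Fin d → ℤ} {r : ℝ} (hd : 2 ≤ d) (hr : 0 < r)
    (hne : x ≠ y) (h : inBox d x r y) :
    ((d : ℝ) * r) ^ 2 / ((d : ℝ) * r) ^ d ≤ invPow d (2 - d) x y := by
  have hd' : (2 : ℝ) ≤ d := by exact_mod_cast hd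
  rw [invPow, if_neg hne, ← rpow_two_sub_natCast (by positivity)]
  exact Real.rpow_le_rpow_of_nonpos (eDist_pos hne)
    (eDist_le_of_inBox (by omega) hr.le h) (by linarith)

lemma invPow_le_of_not_inBox {d : ℕ} {x y : Fin d → ℤ} {r : ℝ} (hd : 2 ≤ d) (hr : 0 < r)
    (h : ¬ inBox d x r y) : invPow d (2 - d) x y ≤ r ^ 2 / r ^ d := by
  have hd' : (2 : ℝ) ≤ d := by exact_mod_cast hd
  obtain ⟨i, hi⟩ : ∃ i, r < |((y i - x i : ℤ) : ℝ)| := by simpa [inBox] using h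
  have hne : x ≠ y := by
    rintro rfl
    simp at hi
    linarith
  rw [invPow, if_neg hne, ← rpow_two_sub_natCast hr]
  exact Real.rpow_le_rpow_of_nonpos hr (hi.le.trans (abs_coord_le_eDist d x y i)) (by linarith)

/-- A box of radius at least one contains at most `(3 r) ^ d` lattice points. -/
lemma card_le_of_forall_inBox {d : ℕ} {x : Fin d → ℤ} {r : ℝ} (hr : 1 ≤ r)
    (F : Finset (Fin d → ℤ)) (hF : ∀ y ∈ F, inBox d x r y) : (F.card : ℝ) ≤ (3 * r) ^ d := by
  have hsub : F ⊆ Fintype.piFinset fun i => Finset.Icc (x i - ⌊r⌋) (x i + ⌊r⌋) := by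
    intro y hy
    rw [Fintype.mem_piFinset]
    intro i
    have h : |y i - x i| ≤ ⌊r⌋ := by
      rw [Int.le_floor, Int.cast_abs]
      exact hF y hy i
    rw [abs_le] at h
    rw [Finset.mem_Icc]
    omega
  have hfloor : 1 ≤ ⌊r⌋ := Int.le_floor.mpr (by exact_mod_cast hr)
  have hcard := Finset.card_le_card hsub
  rw [Fintype.card_piFinset] at hcard
  have hIcc : ∀ i, ((Finset.Icc (x i - ⌊r⌋) (x i + ⌊r⌋)).card : ℝ) ≤ 3 * r := by
    intro i
    rw [Int.card_Icc]
    have h : (((x i + ⌊r⌋ + 1 - (x i - ⌊r⌋)).toNat : ℤ) : ℝ) = 2 * (⌊r⌋ : ℝ) + 1 := by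
      rw [Int.toNat_of_nonneg (by omega)]
      push_cast
      ring
    rw [Int.cast_natCast] at h
    rw [h]
    linarith [Int.floor_le r]
  calc (F.card : ℝ)
      ≤ ∏ i, ((Finset.Icc (x i - ⌊r⌋) (x i + ⌊r⌋)).card : ℝ) := by exact_mod_cast hcard
    _ ≤ ∏ _i : Fin d, 3 * r := Finset.prod_le_prod (fun _ _ => by positivity) fun i _ => hIcc i
    _ = (3 * r) ^ d := by simp

/-- The inverse-distance mass of a dyadic annulus is at most of the order of its squared radius. -/
lemma sum_invPow_annulus_le {d : ℕ} (hd : 2 ≤ d) {x : Fin d → ℤ} {r : ℝ} (hr : 0 < r)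
    (F : Finset (Fin d → ℤ)) (hF : ∀ y ∈ F, inBox d x (2 * r) y ∧ ¬ inBox d x r y) :
    ∑ y ∈ F, invPow d (2 - d) x y ≤ 6 ^ d * r ^ 2 := by
  rcases F.eq_empty_or_nonempty with rfl | ⟨z, hz⟩
  · simp only [Finset.sum_empty]
    positivity
  have hr1 : 1 ≤ 2 * r := by
    obtain ⟨hz1, hz2⟩ := hF z hz
    obtain ⟨i, hi⟩ : ∃ i, r < |((z i - x i : ℤ) : ℝ)| := by simpa [inBox] using hz2
    have hne : z i - x i ≠ 0 := by
      intro h0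
      rw [h0] at hi
      simp at hi
      linarith
    have h1 : (1 : ℝ) ≤ |((z i - x i : ℤ) : ℝ)| := by
      rw [← Int.cast_abs]
      exact_mod_cast Int.one_le_abs hne
    exact h1.trans (hz1 i)
  calc ∑ y ∈ F, invPow d (2 - d) x y
      ≤ ∑ _y ∈ F, r ^ 2 / r ^ d :=
        Finset.sum_le_sum fun y hy => invPow_le_of_not_inBox hd hr (hF y hy).2
    _ = F.card * (r ^ 2 / r ^ d) := by rw [Finset.sum_const, nsmul_eq_mul]
    _ ≤ (3 * (2 * r)) ^ d * (r ^ 2 / r ^ d) := by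
        gcongr
        exact card_le_of_forall_inBox hr1 F fun y hy => (hF y hy).1
    _ = 6 ^ d * r ^ 2 := by
        rw [← mul_assoc 3 2 r, mul_pow]
        field_simp
        norm_num

/-- The total inverse-distance mass of a set with at least two points in a box. -/
lemma le_sum_erase_invPow {d : ℕ} (hd : 2 ≤ d) {x : Fin d → ℤ} {r : ℝ} (hr : 0 < r)
    (A : Finset (Fin d → ℤ)) (hA : ∀ y ∈ A, inBox d x r y) (hcard : 2 ≤ A.card) :
    (1 / 2) * A.card * ((d * r) ^ 2 / (d * r) ^ d) ≤ ∑ y ∈ A.erase x, invPow d (2 - d) x y := by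
  have hE : (1 / 2 : ℝ) * A.card ≤ (A.erase x).card := by
    have h1 : A.card ≤ (A.erase x).card + 1 := by
      have := Finset.pred_card_le_card_erase (s := A) (a := x)
      omega
    have h2 : (A.card : ℝ) ≤ (A.erase x).card + 1 := by exact_mod_cast h1
    have h3 : (2 : ℝ) ≤ A.card := by exact_mod_cast hcard
    linarith
  calc (1 / 2) * A.card * ((d * r) ^ 2 / (d * r) ^ d)
      ≤ (A.erase x).card * ((d * r) ^ 2 / (d * r) ^ d) := by gcongr
    _ = ∑ _y ∈ A.erase x, ((d : ℝ) * r) ^ 2 / (d * r) ^ d := by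
        rw [Finset.sum_const, nsmul_eq_mul]
    _ ≤ _ := Finset.sum_le_sum fun y hy =>
        le_invPow_of_inBox hd hr (Finset.ne_of_mem_erase hy).symm (hA y (Finset.mem_of_mem_erase hy))

lemma ten_mul_pow_le_two_pow {d k : ℕ} (hd : 1 ≤ d)
    (hk : 100 * (d : ℝ) * Real.logb 2 (10 * d) ≤ (k : ℝ)) : (10 * d) ^ (100 * d) ≤ 2 ^ k := by
  have hd' : (1 : ℝ) ≤ d := by exact_mod_cast hd
  have h : ((10 * d : ℝ)) ^ (100 * d) ≤ 2 ^ k := by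
    have h1 : Real.logb 2 ((10 * d : ℝ) ^ (100 * d)) ≤ k := by
      rw [Real.logb_pow]
      push_cast
      exact hk
    rw [Real.logb_le_iff_le_rpow (by norm_num) (by positivity), Real.rpow_natCast] at h1
    exact h1
  exact_mod_cast h

lemma pow_four_lt_two_pow {n : ℕ} (hn : 17 ≤ n) : n ^ 4 < 2 ^ n := by
  induction n, hn using Nat.le_induction with
  | base => norm_num
  | succ n hn ih =>
    have h : (n + 1) ^ 4 ≤ 2 * n ^ 4 := by
      obtain ⟨m, rfl⟩ := Nat.exists_eq_add_of_le hn
      ring_nf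
      nlinarith [sq_nonneg m, pow_pos (show 0 < m + 1 by omega) 3, Nat.zero_le (m ^ 3),
        Nat.zero_le (m ^ 4)]
    rw [pow_succ 2]
    omega

/-- The exponent of the scale of a heavy annulus does not exceed `k`. -/
lemma le_of_four_pow_le {d k l : ℕ} (hd : 1 ≤ d) (hk : (10 * d) ^ (100 * d) ≤ 2 ^ k)
    (h : 4 ^ l ≤ l ^ 2 * 2 ^ k * (12 * d) ^ d) : l ≤ k := by
  by_contra! hlt
  have hkl : 2 ^ k ≤ 2 ^ l := Nat.pow_le_pow_right (by norm_num) hlt.le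
  have h17 : 17 ≤ l := by
    by_contra! hl
    have h1 : (10 : ℕ) ^ 100 ≤ (10 * d) ^ (100 * d) :=
      (Nat.pow_le_pow_left (by omega) 100).trans (Nat.pow_le_pow_right (by omega) (by omega))
    have h2 : 2 ^ l ≤ 2 ^ 17 := Nat.pow_le_pow_right (by norm_num) hl.le
    have h3 : 2 ^ 17 < 10 ^ 100 := by norm_num
    omega
  have h2l : 2 ^ l ≤ l ^ 2 * (12 * d) ^ d := by
    have h1 : 2 ^ l * 2 ^ l ≤ 2 ^ l * (l ^ 2 * (12 * d) ^ d) :=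
      calc 2 ^ l * 2 ^ l = 4 ^ l := by rw [← mul_pow]; norm_num
        _ ≤ l ^ 2 * 2 ^ k * (12 * d) ^ d := h
        _ ≤ l ^ 2 * 2 ^ l * (12 * d) ^ d := by gcongr
        _ = _ := by ring
    exact Nat.le_of_mul_le_mul_left h1 (by positivity)
  have h12 : ((12 * d) ^ d) ^ 2 ≤ 2 ^ l :=
    calc ((12 * d) ^ d) ^ 2 = ((12 * d) ^ 2) ^ d := by rw [← pow_mul, ← pow_mul, mul_comm d 2]
      _ ≤ ((10 * d) ^ 100) ^ d := by
          refine Nat.pow_le_pow_left ?_ d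
          calc (12 * d) ^ 2 ≤ ((10 * d) ^ 2) ^ 2 := Nat.pow_le_pow_left (by nlinarith) 2
            _ = (10 * d) ^ 4 := by rw [← pow_mul]
            _ ≤ (10 * d) ^ 100 := Nat.pow_le_pow_right (by omega) (by norm_num)
      _ = (10 * d) ^ (100 * d) := by rw [← pow_mul]
      _ ≤ 2 ^ l := hk.trans hkl
  have hfin : 2 ^ l * 2 ^ l ≤ l ^ 4 * 2 ^ l :=
    calc 2 ^ l * 2 ^ l ≤ (l ^ 2 * (12 * d) ^ d) * (l ^ 2 * (12 * d) ^ d) := Nat.mul_le_mul h2l h2l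
      _ = l ^ 4 * ((12 * d) ^ d) ^ 2 := by ring
      _ ≤ l ^ 4 * 2 ^ l := by gcongr
  have := Nat.le_of_mul_le_mul_right hfin (by positivity)
  exact absurd (pow_four_lt_two_pow h17) (by omega)

theorem stmt_2 (d k : ℕ) (hd : 3 ≤ d)
    (hk : 100 * (d : ℝ) * Real.logb 2 (10 * d) ≤ (k : ℝ))
    (Nh : ℝ) (hN1 : 1 ≤ Nh) (hN2 : (2 : ℝ) ≤ (2 : ℝ) ^ (-(k : ℝ)) * Nh ^ (d : ℝ))
    (x : Fin d → ℤ) (A : Finset (Fin d → ℤ))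
    (hA : ∀ y ∈ A, inBox d x (2 * Nh) y)
    (hcard : (2 : ℝ) ^ (-(k : ℝ)) * Nh ^ (d : ℝ) ≤ (A.card : ℝ))
    (l : ℕ) (hl : 1 ≤ l)
    (hheavy :
      (1 / 2) * ((l : ℝ) ^ 2)⁻¹ * ∑ y ∈ A.erase x, invPow d (2 - d) x y ≤
        ∑ y ∈ A.filter (fun y =>
          inBox d x ((2 : ℝ) ^ ((2 : ℝ) - l) * Nh) y ∧
          ¬ inBox d x ((2 : ℝ) ^ ((1 : ℝ) - l) * Nh) y), invPow d (2 - d) x y) :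
    l ≤ k ∧
    (d : ℝ) ^ (-(4 * (d : ℝ))) * (k : ℝ)⁻¹ * (2 : ℝ) ^ (-(k : ℝ) / 2) ≤ (2 : ℝ) ^ (-(l : ℝ)) ∧
    (1 / 2) * (d : ℝ) ^ (-(2 * (d : ℝ))) * ((k : ℝ) ^ 2)⁻¹ * (2 : ℝ) ^ (-(k : ℝ)) * Nh ^ 2 ≤
      ∑ y ∈ A.filter (fun y =>
        inBox d x ((2 : ℝ) ^ ((2 : ℝ) - l) * Nh) y ∧
        ¬ inBox d x ((2 : ℝ) ^ ((1 : ℝ) - l) * Nh) y), invPow d (2 - d) x y := by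
  have hd3 : (3 : ℝ) ≤ d := by exact_mod_cast hd
  have hl0 : (1 : ℝ) ≤ l := by exact_mod_cast hl
  have hN0 : 0 < Nh := by linarith
  have hk2 : (2 : ℝ) ^ (-(k : ℝ)) = ((2 : ℝ) ^ k)⁻¹ := by
    rw [Real.rpow_neg (by norm_num), Real.rpow_natCast]
  have hl2 : (2 : ℝ) ^ (-(l : ℝ)) = ((2 : ℝ) ^ l)⁻¹ := by
    rw [Real.rpow_neg (by norm_num), Real.rpow_natCast]
  have houter : (2 : ℝ) ^ ((2 : ℝ) - l) * Nh = 2 * (2 / 2 ^ l * Nh) := by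
    rw [Real.rpow_sub (by norm_num), Real.rpow_natCast, Real.rpow_two]
    ring
  have hinner : (2 : ℝ) ^ ((1 : ℝ) - l) * Nh = 2 / 2 ^ l * Nh := by
    rw [Real.rpow_sub (by norm_num), Real.rpow_natCast, Real.rpow_one]
  rw [houter, hinner] at hheavy ⊢
  rw [hk2, Real.rpow_natCast] at hN2 hcard
  rw [hk2, hl2]
  have hupper := sum_invPow_annulus_le (d := d) (x := x) (r := 2 / 2 ^ l * Nh) (by omega)
    (by positivity)
    (A.filter fun y => inBox d x (2 * (2 / 2 ^ l * Nh)) y ∧ ¬ inBox d x (2 / 2 ^ l * Nh) y)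
    (fun y hy => (Finset.mem_filter.mp hy).2)
  set H := ∑ y ∈ A.filter (fun y =>
    inBox d x (2 * (2 / 2 ^ l * Nh)) y ∧ ¬ inBox d x (2 / 2 ^ l * Nh) y), invPow d (2 - d) x y
  have hS := le_sum_erase_invPow (by omega : 2 ≤ d) (by positivity : 0 < 2 * Nh) A hA
    (by exact_mod_cast hN2.trans hcard)
  have hlower : (1 / 4) * ((l : ℝ) ^ 2)⁻¹ * ((2 : ℝ) ^ k)⁻¹ * Nh ^ 2 *
      ((2 * d) ^ 2 / (2 * d) ^ d) ≤ H :=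
    calc (1 / 4) * ((l : ℝ) ^ 2)⁻¹ * ((2 : ℝ) ^ k)⁻¹ * Nh ^ 2 * ((2 * d) ^ 2 / (2 * d) ^ d)
        = (1 / 2) * ((l : ℝ) ^ 2)⁻¹ * ((1 / 2) * (((2 : ℝ) ^ k)⁻¹ * Nh ^ d) *
            ((d * (2 * Nh)) ^ 2 / (d * (2 * Nh)) ^ d)) := by
          rw [show (d : ℝ) * (2 * Nh) = 2 * d * Nh by ring, mul_pow (2 * (d : ℝ)) Nh,
            mul_pow (2 * (d : ℝ)) Nh]
          field_simp
          norm_num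
      _ ≤ (1 / 2) * ((l : ℝ) ^ 2)⁻¹ * ((1 / 2) * A.card *
            ((d * (2 * Nh)) ^ 2 / (d * (2 * Nh)) ^ d)) := by gcongr
      _ ≤ (1 / 2) * ((l : ℝ) ^ 2)⁻¹ * ∑ y ∈ A.erase x, invPow d (2 - d) x y := by gcongr
      _ ≤ H := hheavy
  have hfour : (4 : ℝ) ^ l ≤ l ^ 2 * 2 ^ k * (12 * d) ^ d := by
    have h1 := hlower.trans hupper
    have h4 : (4 : ℝ) ^ l = 2 ^ l * 2 ^ l := by rw [← mul_pow]; norm_num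
    have h12 : (12 * (d : ℝ)) ^ d = 6 ^ d * (2 * d) ^ d := by rw [← mul_pow]; congr 1; ring
    have h2 : (4 : ℝ) ^ l * (2 * d) ^ 2 ≤ 16 * (l ^ 2 * 2 ^ k * (12 * d) ^ d) := by
      rw [h4, h12]
      have hc : 0 ≤ 4 * (l : ℝ) ^ 2 * 2 ^ k * (2 * d) ^ d * (2 ^ l * 2 ^ l) / Nh ^ 2 := by
        positivity
      have h3 := mul_le_mul_of_nonneg_right h1 hc
      calc (2 : ℝ) ^ l * 2 ^ l * (2 * d) ^ 2
          = 1 / 4 * ((l : ℝ) ^ 2)⁻¹ * (2 ^ k)⁻¹ * Nh ^ 2 * ((2 * d) ^ 2 / (2 * d) ^ d) *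
              (4 * l ^ 2 * 2 ^ k * (2 * d) ^ d * (2 ^ l * 2 ^ l) / Nh ^ 2) := by field_simp
        _ ≤ 6 ^ d * (2 / 2 ^ l * Nh) ^ 2 *
              (4 * l ^ 2 * 2 ^ k * (2 * d) ^ d * (2 ^ l * 2 ^ l) / Nh ^ 2) := h3
        _ = 16 * (l ^ 2 * 2 ^ k * (6 ^ d * (2 * d) ^ d)) := by
          field_simp
          norm_num
    have h16 : (16 : ℝ) ≤ (2 * d) ^ 2 := by nlinarith
    have h5 : (4 : ℝ) ^ l * 16 ≤ 4 ^ l * (2 * d) ^ 2 := by gcongr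
    linarith
  have hlk : l ≤ k := le_of_four_pow_le (by omega) (ten_mul_pow_le_two_pow (by omega) hk)
    (by exact_mod_cast hfour)
  have hlk' : (l : ℝ) ≤ k := by exact_mod_cast hlk
  have hk0 : (0 : ℝ) < k := by linarith
  refine ⟨hlk, ?_, ?_⟩
  · have hhalf : (2 : ℝ) ^ (-(k : ℝ) / 2) = (√(2 ^ k))⁻¹ := by
      rw [neg_div, Real.rpow_neg (by norm_num), Real.sqrt_eq_rpow, ← Real.rpow_natCast,
        ← Real.rpow_mul (by norm_num)]
      congr 2
      ring
    have hdd : (d : ℝ) ^ (-(4 * (d : ℝ))) = ((d : ℝ) ^ (4 * d))⁻¹ := by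
      rw [Real.rpow_neg (by positivity), ← Real.rpow_natCast]
      push_cast
      rfl
    rw [hhalf, hdd, ← mul_inv, ← mul_inv]
    refine inv_anti₀ (by positivity) ((sq_le_sq₀ (by positivity) (by positivity)).mp ?_)
    have h12 : (12 * (d : ℝ)) ^ d ≤ (d ^ (4 * d)) ^ 2 :=
      calc (12 * (d : ℝ)) ^ d ≤ (d ^ 8) ^ d := by
            gcongr
            have h7 : (3 : ℝ) ^ 7 ≤ d ^ 7 := by gcongr
            rw [pow_succ (d : ℝ) 7]
            gcongr
            linarith
        _ = (d ^ (4 * d)) ^ 2 := by rw [← pow_mul, ← pow_mul]; congr 1; ring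
    calc ((2 : ℝ) ^ l) ^ 2 = 4 ^ l := by rw [← pow_mul, mul_comm, pow_mul]; norm_num
      _ ≤ l ^ 2 * 2 ^ k * (12 * d) ^ d := hfour
      _ ≤ k ^ 2 * 2 ^ k * (d ^ (4 * d)) ^ 2 := by gcongr
      _ = (d ^ (4 * d) * k * √(2 ^ k)) ^ 2 := by
        rw [mul_pow, mul_pow, Real.sq_sqrt (by positivity)]
        ring
  · have hdd : (d : ℝ) ^ (-(2 * (d : ℝ))) = ((d : ℝ) ^ (2 * d))⁻¹ := by
      rw [Real.rpow_neg (by positivity), ← Real.rpow_natCast]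
      push_cast
      rfl
    have hdim : (1 / 2 : ℝ) * ((d : ℝ) ^ (2 * d))⁻¹ ≤ 1 / 4 * ((2 * d) ^ 2 / (2 * d) ^ d) := by
      have h1 : (2 * (d : ℝ)) ^ d ≤ d ^ (2 * d) := by
        rw [pow_mul]
        gcongr
        nlinarith
      calc (1 / 2 : ℝ) * ((d : ℝ) ^ (2 * d))⁻¹ ≤ 1 / 2 * ((2 * (d : ℝ)) ^ d)⁻¹ := by gcongr
        _ ≤ 1 / 4 * (2 * d) ^ 2 * ((2 * (d : ℝ)) ^ d)⁻¹ := by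
          gcongr
          nlinarith
        _ = _ := by ring
    rw [hdd]
    calc (1 / 2) * ((d : ℝ) ^ (2 * d))⁻¹ * ((k : ℝ) ^ 2)⁻¹ * ((2 : ℝ) ^ k)⁻¹ * Nh ^ 2
        ≤ 1 / 4 * ((2 * d) ^ 2 / (2 * d) ^ d) * ((l : ℝ) ^ 2)⁻¹ * ((2 : ℝ) ^ k)⁻¹ * Nh ^ 2 := by
          gcongr
      _ = (1 / 4) * ((l : ℝ) ^ 2)⁻¹ * ((2 : ℝ) ^ k)⁻¹ * Nh ^ 2 *
            ((2 * d) ^ 2 / (2 * d) ^ d) := by ring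
      _ ≤ H := hlower
end

section
/- For every integer $d \ge 3$ there exists a constant $C > 0$, depending only on $d$, such that for every real $N \ge 1$ and every $x \in \partial^{\mathrm e}\mathcal{B}(N)$, one has $\sum_{y \in \partial^{\mathrm e}\mathcal{B}(N)} |x-y|^{2-d} \le C N$, where the convention $0^{2-d} := 1$ is used for the term $y = x$. -/
open Classical

/-- Lattice adjacency: `x ∼ y` iff `|x - y| = 1`. -/
def adj (d : ℕ) (x y : Fin d → ℤ) : Prop :=
  ∑ i, (x i - y i) ^ 2 = 1

/-- The Euclidean lattice ball `𝓑(N) = {y ∈ ℤ^d : |y| ≤ N}`. -/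
def eBall (d : ℕ) (N : ℝ) : Set (Fin d → ℤ) :=
  {y | Real.sqrt (∑ i, ((y i : ℤ) : ℝ) ^ 2) ≤ N}

/-- The external boundary `∂ᵉ𝓑(N)` of the Euclidean lattice ball. -/
def extBd (d : ℕ) (N : ℝ) : Set (Fin d → ℤ) :=
  {x | x ∉ eBall d N ∧ ∃ y ∈ eBall d N, adj d x y}

lemma sq_norm_bounds_of_mem_extBd {d : ℕ} {N : ℝ} (hN : 1 ≤ N) {y : Fin d → ℤ}
    (hy : y ∈ extBd d N) :
    N ^ 2 < ∑ i, (y i : ℝ) ^ 2 ∧ ∑ i, (y i : ℝ) ^ 2 ≤ (N + 1) ^ 2 := by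
  obtain ⟨hout, z, hz, hadj⟩ := hy
  simp only [eBall, Set.mem_ofPred_eq, not_le] at hout hz
  have hz2 : ∑ i, (z i : ℝ) ^ 2 ≤ N ^ 2 := (Real.sqrt_le_left (by linarith)).1 hz
  have he : ∑ i, ((y i : ℝ) - z i) ^ 2 = 1 := by
    unfold adj at hadj
    exact_mod_cast hadj
  refine ⟨(Real.lt_sqrt (by linarith)).1 hout, ?_⟩
  have hcs := Finset.sum_mul_sq_le_sq_mul_sq Finset.univ
    (fun i => (z i : ℝ)) (fun i => (y i : ℝ) - z i)
  rw [he, mul_one] at hcs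
  have hin : ∑ i, (z i : ℝ) * ((y i : ℝ) - z i) ≤ N :=
    le_of_sq_le_sq (hcs.trans hz2) (by linarith)
  have hexp : ∑ i, (y i : ℝ) ^ 2 = ∑ i, (z i : ℝ) ^ 2
      + 2 * ∑ i, (z i : ℝ) * ((y i : ℝ) - z i) + ∑ i, ((y i : ℝ) - z i) ^ 2 := by
    rw [Finset.mul_sum, ← Finset.sum_add_distrib, ← Finset.sum_add_distrib]
    exact Finset.sum_congr rfl fun i _ => by ring
  rw [hexp, he]
  nlinarith

lemma abs_apply_le_of_mem_extBd {d : ℕ} {N : ℝ} (hN : 1 ≤ N) {y : Fin d → ℤ}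
    (hy : y ∈ extBd d N) (i : Fin d) : |(y i : ℝ)| ≤ N + 1 := by
  apply abs_le_of_sq_le_sq _ (by linarith)
  exact (Finset.single_le_sum (f := fun i => (y i : ℝ) ^ 2) (fun j _ => sq_nonneg _)
    (Finset.mem_univ i)).trans (sq_norm_bounds_of_mem_extBd hN hy).2

/-- Two boundary points that agree off a dominant coordinate `i`, and whose `i`-th coordinates have
the same sign and the same residue modulo `3 * d`, coincide. -/
lemma eq_of_agree_off_dominant {d : ℕ} {N : ℝ} (hN : 1 ≤ N) {y z : Fin d → ℤ}
    (hy : y ∈ extBd d N) (hz : z ∈ extBd d N) {i : Fin d}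
    (hyi : ∀ l, |y l| ≤ |y i|) (hzi : ∀ l, |z l| ≤ |z i|)
    (hoff : ∀ l, l ≠ i → y l = z l) (hmod : y i % (3 * d) = z i % (3 * d))
    (hsign : 0 ≤ y i ↔ 0 ≤ z i) : y = z := by
  have hdom : ∀ w : Fin d → ℤ, w ∈ extBd d N → (∀ l, |w l| ≤ |w i|) →
      N ^ 2 < d * (w i : ℝ) ^ 2 := by
    intro w hw hwi
    refine (sq_norm_bounds_of_mem_extBd hN hw).1.trans_le ?_
    have := Finset.sum_le_card_nsmul Finset.univ (fun l => (w l : ℝ) ^ 2) ((w i : ℝ) ^ 2)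
      (fun l _ => by exact_mod_cast sq_le_sq.2 (hwi l))
    simpa using this
  have hy1 := hdom y hy hyi
  have hz1 := hdom z hz hzi
  obtain ⟨hy2, hy3⟩ := sq_norm_bounds_of_mem_extBd hN hy
  obtain ⟨hz2, hz3⟩ := sq_norm_bounds_of_mem_extBd hN hz
  have hsum : ∑ l, (y l : ℝ) ^ 2 - ∑ l, (z l : ℝ) ^ 2 = (y i : ℝ) ^ 2 - (z i : ℝ) ^ 2 := by
    rw [← Finset.sum_sub_distrib]
    refine Finset.sum_eq_single i (fun l _ hl => ?_) (by simp)
    rw [hoff l hl, sub_self]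
  have hdpos : (1 : ℝ) ≤ d := by exact_mod_cast (Fin.pos i)
  have hprod : 0 ≤ (y i : ℝ) * z i := by
    have : 0 ≤ y i * z i := by
      by_cases h : 0 ≤ y i
      · exact mul_nonneg h (hsign.1 h)
      · exact mul_nonneg_of_nonpos_of_nonpos (by omega) (by have := mt hsign.2 h; omega)
    exact_mod_cast this
  by_contra hne
  have hnei : y i ≠ z i := by
    intro h
    refine hne (funext fun l => ?_)
    by_cases hl : l = i
    · rw [hl, h]
    · exact hoff l hl
  have hgap : ((3 * d : ℕ) : ℝ) ^ 2 ≤ ((y i : ℝ) - z i) ^ 2 := by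
    have hdvd : ((3 * d : ℕ) : ℤ) ∣ y i - z i := by
      push_cast
      exact Int.ModEq.dvd (Int.ModEq.symm hmod)
    have hle := Int.le_of_dvd (abs_pos.2 (sub_ne_zero.2 hnei)) ((dvd_abs _ _).2 hdvd)
    have : ((3 * d : ℕ) : ℤ) ^ 2 ≤ (y i - z i) ^ 2 := by
      rw [sq_le_sq]
      simpa using hle
    exact_mod_cast this
  push_cast at hgap
  have hupper : ((y i : ℝ) ^ 2 - (z i : ℝ) ^ 2) ^ 2 ≤ (3 * N) ^ 2 :=
    sq_le_sq' (by nlinarith) (by nlinarith)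
  have hadd : 2 * N ^ 2 ≤ d * ((y i : ℝ) + z i) ^ 2 := by nlinarith
  have hlower : (3 * (d : ℝ)) ^ 2 * (2 * N ^ 2)
      ≤ ((y i : ℝ) - z i) ^ 2 * (d * ((y i : ℝ) + z i) ^ 2) :=
    mul_le_mul hgap hadd (by positivity) (sq_nonneg _)
  have hfactor : ((y i : ℝ) - z i) ^ 2 * (d * ((y i : ℝ) + z i) ^ 2)
      = d * ((y i : ℝ) ^ 2 - (z i : ℝ) ^ 2) ^ 2 := by ring
  have hcmp : (d : ℝ) * ((y i : ℝ) ^ 2 - (z i : ℝ) ^ 2) ^ 2 ≤ d * (3 * N) ^ 2 :=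
    mul_le_mul_of_nonneg_left hupper (by linarith)
  have hpos : 0 < (d : ℝ) * N ^ 2 := by positivity
  nlinarith

/-- The points with dominant coordinate `i` whose distance to `x` off `i`, in the sup norm,
is `n` and is attained at coordinate `j`. -/
def IsShellPoint {d : ℕ} (x : Fin d → ℤ) (i j : Fin d) (n : ℕ) (y : Fin d → ℤ) : Prop :=
  j ≠ i ∧ (∀ l, |y l| ≤ |y i|) ∧ (∀ l, l ≠ i → |x l - y l| ≤ n) ∧ |x j - y j| = n

lemma exists_isShellPoint {d : ℕ} (hd : 2 ≤ d) (x y : Fin d → ℤ) :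
    ∃ i j, IsShellPoint x i j (x j - y j).natAbs y := by
  have : Nontrivial (Fin d) := Fin.nontrivial_iff_two_le.2 hd
  have : Nonempty (Fin d) := inferInstance
  obtain ⟨i, -, hi⟩ := Finset.exists_max_image Finset.univ (fun l => |y l|) Finset.univ_nonempty
  obtain ⟨k, hk⟩ := exists_ne i
  obtain ⟨j, hj, hmax⟩ := Finset.exists_max_image (Finset.univ.erase i) (fun l => |x l - y l|)
    ⟨k, by simpa using hk⟩
  refine ⟨i, j, by simpa using hj, fun l => hi l (Finset.mem_univ l), fun l hl => ?_, by simp⟩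
  simpa using hmax l (by simpa using hl)

lemma card_shell_le {d : ℕ} {N : ℝ} (hN : 1 ≤ N) (x : Fin d → ℤ) (i j : Fin d) (n : ℕ)
    (T : Finset (Fin d → ℤ)) (hT : ∀ y ∈ T, y ∈ extBd d N ∧ IsShellPoint x i j n y) :
    T.card ≤ 12 * d * (2 * n + 1) ^ (d - 2) := by
  rcases T.eq_empty_or_nonempty with rfl | ⟨y₀, hy₀⟩
  · simp
  have hji : j ≠ i := (hT y₀ hy₀).2.1
  have hd : 0 < d := Fin.pos i
  let box : Fin d → Finset ℤ := fun l =>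
    if l = i then Finset.Ico 0 (3 * d : ℤ)
    else if l = j then {x j - n, x j + n} else Finset.Icc (x l - n) (x l + n)
  let code : (Fin d → ℤ) → Bool × (Fin d → ℤ) := fun y =>
    (decide (0 ≤ y i), Function.update y i (y i % (3 * d)))
  have hcode : ∀ y ∈ T, code y ∈ (Finset.univ : Finset Bool) ×ˢ Fintype.piFinset box := by
    intro y hy
    obtain ⟨-, -, -, hle, heq⟩ := hT y hy
    simp only [code, Finset.mem_product, Finset.mem_univ, true_and, Fintype.mem_piFinset]
    intro l
    by_cases hli : l = i
    · subst hli
      simp only [box, Function.update_self, if_true, Finset.mem_Ico]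
      exact ⟨Int.emod_nonneg _ (by omega), Int.emod_lt_of_pos _ (by omega)⟩
    · rw [Function.update_of_ne hli]
      by_cases hlj : l = j
      · subst hlj
        simp only [box, if_neg hli, if_true, Finset.mem_insert, Finset.mem_singleton]
        rcases abs_eq (by positivity : (0 : ℤ) ≤ n) |>.1 heq with h | h <;> omega
      · simp only [box, if_neg hli, if_neg hlj, Finset.mem_Icc]
        have := abs_le.1 (hle l hli)
        omega
  have hinj : Set.InjOn code T := by
    intro y hy z hz h
    obtain ⟨hyB, -, hyi, -⟩ := hT y hy
    obtain ⟨hzB, -, hzi, -⟩ := hT z hz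
    simp only [code, Prod.mk.injEq, decide_eq_decide] at h
    refine eq_of_agree_off_dominant hN hyB hzB hyi hzi (fun l hl => ?_) ?_ h.1
    · simpa [hl] using congrFun h.2 l
    · simpa using congrFun h.2 i
  have hcard := Finset.card_le_card_of_injOn code hcode hinj
  rw [Finset.card_product, Fintype.card_piFinset, Finset.card_univ, Fintype.card_bool,
    ← Finset.mul_prod_erase _ _ (Finset.mem_univ i),
    ← Finset.mul_prod_erase _ _ (Finset.mem_erase.2 ⟨hji, Finset.mem_univ j⟩)] at hcard
  have hi : (box i).card = 3 * d := by
    simp only [box, if_true, Int.card_Ico]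
    omega
  have hj : (box j).card ≤ 2 := by
    simp only [box, if_neg hji, if_true]
    exact Finset.card_le_two
  have hrest : ∏ l ∈ (Finset.univ.erase i).erase j, (box l).card = (2 * n + 1) ^ (d - 2) := by
    rw [Finset.prod_congr rfl (g := fun _ => 2 * n + 1), Finset.prod_const,
      Finset.card_erase_of_mem (by simpa using hji), Finset.card_erase_of_mem (Finset.mem_univ i),
      Finset.card_univ, Fintype.card_fin, Nat.sub_sub]
    intro l hl
    simp only [Finset.mem_erase, Finset.mem_univ, and_true] at hl
    simp only [box, if_neg hl.1, if_neg hl.2, Int.card_Icc]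
    omega
  rw [hi, hrest] at hcard
  calc T.card ≤ 2 * (3 * d * ((box j).card * (2 * n + 1) ^ (d - 2))) := hcard
    _ ≤ 2 * (3 * d * (2 * (2 * n + 1) ^ (d - 2))) := by gcongr
    _ = 12 * d * (2 * n + 1) ^ (d - 2) := by ring

lemma invPow_le {d : ℕ} (hd : 2 ≤ d) {x y : Fin d → ℤ} {j : Fin d} {n : ℕ}
    (hn : |x j - y j| = n) :
    invPow d (2 - d) x y ≤ ((max 1 n : ℕ) ^ (d - 2) : ℝ)⁻¹ := by
  unfold invPow
  split_ifs with h
  · subst h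
    have : n = 0 := by simpa using hn.symm
    simp [this]
  · have hone : (1 : ℤ) ≤ ∑ l, (x l - y l) ^ 2 := by
      obtain ⟨l, hl⟩ := Function.ne_iff.1 h
      have hpos : 0 < (x l - y l) ^ 2 := by
        have := sub_ne_zero.2 hl
        positivity
      exact Int.add_one_le_iff.2 (hpos.trans_le (Finset.single_le_sum
        (f := fun l => (x l - y l) ^ 2) (fun _ _ => sq_nonneg _) (Finset.mem_univ l)))
    have hsq : (n : ℤ) ^ 2 ≤ ∑ l, (x l - y l) ^ 2 := by
      rw [← hn, sq_abs]
      exact Finset.single_le_sum (f := fun l => (x l - y l) ^ 2) (fun _ _ => sq_nonneg _)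
        (Finset.mem_univ j)
    have hmax : (((max 1 n : ℕ) : ℤ)) ^ 2 ≤ ∑ l, (x l - y l) ^ 2 := by
      rcases max_choice 1 n with h | h <;> rw [h]
      · simpa using hone
      · exact hsq
    have hdist : ((max 1 n : ℕ) : ℝ) ≤ eDist d x y :=
      Real.le_sqrt_of_sq_le (by exact_mod_cast hmax)
    have hpos : (0 : ℝ) < (max 1 n : ℕ) := by positivity
    have hd' : (2 : ℝ) ≤ d := by exact_mod_cast hd
    calc eDist d x y ^ (2 - d : ℝ) ≤ ((max 1 n : ℕ) : ℝ) ^ (2 - d : ℝ) :=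
          Real.rpow_le_rpow_of_nonpos hpos hdist (by linarith)
      _ = _ := by
          rw [← Real.rpow_natCast, ← Real.rpow_neg hpos.le, Nat.cast_sub hd]
          congr 1
          push_cast
          ring

lemma sum_shell_le {d : ℕ} (hd : 2 ≤ d) {N : ℝ} (hN : 1 ≤ N) (x : Fin d → ℤ) (i j : Fin d) (n : ℕ)
    (T : Finset (Fin d → ℤ)) (hT : ∀ y ∈ T, y ∈ extBd d N ∧ IsShellPoint x i j n y) :
    ∑ y ∈ T, invPow d (2 - d) x y ≤ 12 * d * 3 ^ (d - 2) := by
  have hpos : (0 : ℝ) < (max 1 n : ℕ) := by positivity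
  have hcard : (T.card : ℝ) ≤ 12 * d * (2 * n + 1) ^ (d - 2) := by
    exact_mod_cast card_shell_le hN x i j n T hT
  have hbase : (2 * n + 1 : ℝ) ≤ 3 * (max 1 n : ℕ) := by
    have : 2 * n + 1 ≤ 3 * max 1 n := by omega
    exact_mod_cast this
  calc ∑ y ∈ T, invPow d (2 - d) x y
      ≤ T.card • ((max 1 n : ℕ) ^ (d - 2) : ℝ)⁻¹ :=
        Finset.sum_le_card_nsmul _ _ _ fun y hy => invPow_le hd (hT y hy).2.2.2.2
    _ ≤ (12 * d * (3 * (max 1 n : ℕ)) ^ (d - 2)) * ((max 1 n : ℕ) ^ (d - 2) : ℝ)⁻¹ := by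
        rw [nsmul_eq_mul]
        gcongr
        exact hcard.trans (by gcongr)
    _ = 12 * d * 3 ^ (d - 2) := by
        rw [mul_pow]
        field_simp

theorem stmt_6 (d : ℕ) (hd : 3 ≤ d) :
    ∃ C : ℝ, 0 < C ∧ ∀ N : ℝ, 1 ≤ N → ∀ x ∈ extBd d N,
      ∀ S : Finset (Fin d → ℤ), (∀ y, y ∈ S ↔ y ∈ extBd d N) →
        ∑ y ∈ S, invPow d (2 - d) x y ≤ C * N := by
  have hd2 : 2 ≤ d := by omega
  refine ⟨d * d * 5 * (12 * d * 3 ^ (d - 2)), by positivity, fun N hN x hx S hS => ?_⟩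
  choose i j hij using exists_isShellPoint hd2 x
  let R := ⌊2 * N⌋₊ + 3
  let label : (Fin d → ℤ) → Fin d × Fin d × ℕ := fun y => (i y, j y, (x (j y) - y (j y)).natAbs)
  have hmaps : ∀ y ∈ S, label y ∈
      (Finset.univ : Finset (Fin d)) ×ˢ (Finset.univ : Finset (Fin d)) ×ˢ Finset.range R := by
    intro y hy
    simp only [label, R, Finset.mem_product, Finset.mem_univ, true_and, Finset.mem_range]
    have hxj := abs_apply_le_of_mem_extBd hN hx (j y)
    have hyj := abs_apply_le_of_mem_extBd hN ((hS y).1 hy) (j y)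
    have hle : (((x (j y) - y (j y)).natAbs : ℕ) : ℝ) ≤ 2 * N + 2 := by
      rw [Nat.cast_natAbs]
      push_cast
      linarith [abs_sub (x (j y) : ℝ) (y (j y))]
    have hlt : (((x (j y) - y (j y)).natAbs : ℕ) : ℝ) < (⌊2 * N⌋₊ + 3 : ℕ) := by
      push_cast
      linarith [Nat.lt_floor_add_one (2 * N)]
    exact_mod_cast hlt
  have hR : (R : ℝ) ≤ 5 * N := by
    have := Nat.floor_le (by linarith : 0 ≤ 2 * N)
    simp only [R]
    push_cast
    linarith
  rw [← Finset.sum_fiberwise_of_maps_to hmaps]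
  refine (Finset.sum_le_card_nsmul _ _ (12 * d * 3 ^ (d - 2) : ℝ) ?_).trans ?_
  · rintro ⟨a, b, n⟩ -
    refine sum_shell_le hd2 hN x a b n _ fun y hy => ?_
    obtain ⟨hyS, hlabel⟩ := Finset.mem_filter.1 hy
    simp only [label, Prod.mk.injEq] at hlabel
    obtain ⟨rfl, rfl, rfl⟩ := hlabel
    exact ⟨(hS y).1 hyS, hij y⟩
  · simp only [Finset.card_product, Finset.card_univ, Fintype.card_fin, Finset.card_range,
      nsmul_eq_mul, Nat.cast_mul]
    calc (d * (d * R) : ℝ) * (12 * d * 3 ^ (d - 2))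
        ≤ (d * (d * (5 * N))) * (12 * d * 3 ^ (d - 2)) := by gcongr
      _ = _ := by ring
end
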